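/- Let n ≥ 2, let U ⊆ ℂⁿ be open, and let v = (Z, F) : U → ℂ^{n+1} × ℂ^{n+1} be holomorphic with −i⟨v(z), conj v(z)⟩ > 0 for all z ∈ U, such that the Hermitian metric g(z), with entries g_{αβ̄} = ∂²K/∂z^α ∂z̄^β for K := −log(−i⟨v, conj v⟩), is positive definite on U. Define the Kähler-covariant derivative D_α v := ∂_α v + (∂_α K) v. If ⟨D_α v(z), D_β v(z)⟩ = 0 for all z ∈ U and all α, β = 1, …, n, then also ⟨v(z), ∂_α v(z)⟩ = 0 for all z ∈ U and all α; i.e. for n > 1 the constraint ⟨D_α v, D_β v⟩ = 0 implies the constraint ⟨D_α v, v⟩ = 0. -/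

import Mathlib

open Matrix
open scoped ComplexOrder

/-- The holomorphic Wirtinger derivative `∂f/∂z^α = ½(∂f/∂x^α − i ∂f/∂y^α)` of a
real-differentiable function `f : ℂⁿ → ℂ`. -/
noncomputable def wirtingerD {n : ℕ} (f : (Fin n → ℂ) → ℂ) (α : Fin n) (z : Fin n → ℂ) : ℂ :=
  (1 / 2 : ℂ) * (fderiv ℝ f z (Pi.single α 1) - Complex.I * fderiv ℝ f z (Pi.single α Complex.I))

/-- The antiholomorphic Wirtinger derivative `∂f/∂z̄^α = ½(∂f/∂x^α + i ∂f/∂y^α)`. -/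
noncomputable def wirtingerDBar {n : ℕ} (f : (Fin n → ℂ) → ℂ) (α : Fin n) (z : Fin n → ℂ) : ℂ :=
  (1 / 2 : ℂ) * (fderiv ℝ f z (Pi.single α 1) + Complex.I * fderiv ℝ f z (Pi.single α Complex.I))

section Holomorphic

open Metric Filter Topology MeasureTheory Complex

variable {E F : Type} [NormedAddCommGroup E] [NormedSpace ℂ E] [FiniteDimensional ℂ E]
  [NormedAddCommGroup F] [NormedSpace ℂ F] [FiniteDimensional ℂ F]

/-- Directional derivatives of a holomorphic map of several variables are holomorphic. -/
theorem differentiableAt_fderiv_apply_of_differentiableOn {U : Set E} (hU : IsOpen U) {f : E → F}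
    (hf : DifferentiableOn ℂ f U) {z₀ : E} (hz₀ : z₀ ∈ U) (v : E) :
    DifferentiableAt ℂ (fun z => fderiv ℂ f z v) z₀ := by
  borelize E
  borelize (E →L[ℂ] F)
  obtain ⟨R, hR, hRU⟩ : ∃ R > 0, ball z₀ (3 * R) ⊆ U ∩ f ⁻¹' ball (f z₀) 1 := by
    have h : U ∩ f ⁻¹' ball (f z₀) 1 ∈ 𝓝 z₀ :=
      inter_mem (hU.mem_nhds hz₀)
        ((hf.differentiableAt (hU.mem_nhds hz₀)).continuousAt.preimage_mem_nhds
          (ball_mem_nhds _ one_pos))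
    obtain ⟨R, hR, h⟩ := Metric.mem_nhds_iff.1 h
    exact ⟨R / 3, by positivity, by rwa [mul_div_cancel₀ _ three_ne_zero]⟩
  have hfd {x : E} (hx : x ∈ ball z₀ (2 * R)) : DifferentiableAt ℂ f x :=
    hf.differentiableAt (hU.mem_nhds (hRU (ball_subset_ball (by linarith) hx)).1)
  have hbound {x : E} (hx : x ∈ ball z₀ (2 * R)) : ‖fderiv ℂ f x‖ ≤ 2 / R := by
    have hsub : ball x R ⊆ ball z₀ (3 * R) :=
      ball_subset_ball' (by rw [mem_ball] at hx; linarith)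
    refine norm_fderiv_le_div_of_mapsTo_ball
      (hf.mono fun y hy => (hRU (hsub hy)).1) (fun y hy => ?_) hR
    have h1 : dist (f y) (f z₀) < 1 := (hRU (hsub hy)).2
    have h2 : dist (f x) (f z₀) < 1 := (hRU (hsub (mem_ball_self hR))).2
    have := dist_triangle_right (f y) (f x) (f z₀)
    rw [mem_closedBall]
    linarith
  set r : ℝ := R / (‖v‖ + 1) with hr
  have hv : 0 < ‖v‖ + 1 := by positivity
  have hr0 : 0 < r := by positivity
  have hmem {x : E} (hx : x ∈ ball z₀ R) {c : ℂ} (hc : ‖c‖ ≤ r) :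
      x + c • v ∈ ball z₀ (2 * R) := by
    have h1 : ‖c • v‖ ≤ R := by
      rw [norm_smul]
      calc ‖c‖ * ‖v‖ ≤ r * (‖v‖ + 1) := by gcongr; linarith
        _ = R := by rw [hr]; field_simp
    have h2 := norm_add_le (x - z₀) (c • v)
    rw [mem_ball, dist_eq_norm] at hx ⊢
    rw [add_sub_right_comm]
    linarith
  have hcirc (t : ℝ) : ‖circleMap 0 r t‖ ≤ r := by simp [abs_of_pos hr0]
  have hrepr : (fun z => fderiv ℂ f z v) =ᶠ[𝓝 z₀] fun z =>
      (2 * Real.pi * I : ℂ)⁻¹ • ∮ w in C(0, r), ((w - 0) ^ 2)⁻¹ • f (z + w • v) := by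
    filter_upwards [ball_mem_nhds z₀ hR] with x hx
    have hline (c : ℂ) : HasDerivAt (fun w : ℂ => x + w • v) v c := by
      simpa using ((hasDerivAt_id c).smul_const v).const_add x
    have hopen : IsOpen ((fun w : ℂ => x + w • v) ⁻¹' U) :=
      hU.preimage (by fun_prop)
    have hdiff : DifferentiableOn ℂ (fun w : ℂ => f (x + w • v))
        ((fun w : ℂ => x + w • v) ⁻¹' U) := fun w hw =>
      ((hf.differentiableAt (hU.mem_nhds hw)).comp w
        (hline w).differentiableAt).differentiableWithinAt
    have hsub : closedBall (0 : ℂ) r ⊆ (fun w : ℂ => x + w • v) ⁻¹' U := fun w hw =>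
      (hRU (ball_subset_ball (by linarith) (hmem hx (by simpa using hw)))).1
    have h1 := cderiv_eq_deriv hopen hdiff hr0 hsub
    have h2 : HasDerivAt (fun w : ℂ => f (x + w • v)) (fderiv ℂ f x v) 0 := by
      have h3 : HasFDerivAt f (fderiv ℂ f x) (x + (0 : ℂ) • v) := by
        simpa using (hfd (ball_subset_ball (by linarith) hx)).hasFDerivAt
      exact h3.comp_hasDerivAt 0 (hline 0)
    rw [h2.deriv] at h1
    exact h1.symm
  refine DifferentiableAt.congr_of_eventuallyEq (DifferentiableAt.const_smul ?_ _) hrepr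
  simp only [circleIntegral]
  set k : ℝ → ℂ := fun t => deriv (circleMap 0 r) t * ((circleMap 0 r t - 0) ^ 2)⁻¹ with hk
  have hkc : Continuous k := by
    have h0 (t : ℝ) : (circleMap 0 r t - 0) ^ 2 ≠ 0 := by
      simp [hr0.ne']
    simp only [hk, deriv_circleMap]
    exact Continuous.mul (by fun_prop) (Continuous.inv₀ (by fun_prop) h0)
  have hcont {x : E} (hx : x ∈ ball z₀ R) :
      Continuous fun t : ℝ => k t • f (x + circleMap 0 r t • v) := by
    refine hkc.smul (continuous_iff_continuousAt.2 fun t => ?_)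
    exact ContinuousAt.comp (f := fun t : ℝ => x + circleMap 0 r t • v)
      (hfd (hmem hx (hcirc t))).continuousAt (by fun_prop)
  simp only [smul_smul]
  have hz₀R := mem_ball_self (x := z₀) hR
  refine (intervalIntegral.hasFDerivAt_integral_of_dominated_of_fderiv_le (𝕜 := ℂ)
    (F := fun x t => k t • f (x + circleMap 0 r t • v))
    (F' := fun x t => k t • fderiv ℂ f (x + circleMap 0 r t • v))
    (bound := fun t => ‖k t‖ * (2 / R)) (ball_mem_nhds z₀ hR) ?_ ?_ ?_ ?_ ?_ ?_).differentiableAt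
  · filter_upwards [ball_mem_nhds z₀ hR] with x hx using (hcont hx).aestronglyMeasurable
  · exact (hcont hz₀R).intervalIntegrable _ _
  · exact hkc.aestronglyMeasurable.smul
      (((measurable_fderiv ℂ f).comp (by fun_prop)).aestronglyMeasurable)
  · refine .of_forall fun t _ x hx => ?_
    rw [norm_smul]
    gcongr
    exact hbound (hmem hx (hcirc t))
  · exact (Continuous.mul (by fun_prop) continuous_const).intervalIntegrable _ _
  · refine .of_forall fun t _ x hx => ?_
    exact ((hasFDerivAt_comp_add_right _).2 (hfd (hmem hx (hcirc t))).hasFDerivAt).const_smul _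

/-- Holomorphic maps of several variables are twice continuously differentiable. -/
theorem contDiffOn_two_of_differentiableOn {U : Set E} (hU : IsOpen U) {f : E → F}
    (hf : DifferentiableOn ℂ f U) : ContDiffOn ℂ 2 f U := by
  have hC1 {g : E → F} (hg : DifferentiableOn ℂ g U) : ContDiffOn ℂ 1 g U := by
    rw [← zero_add 1, contDiffOn_succ_iff_fderiv_of_isOpen hU]
    refine ⟨hg, by simp, contDiffOn_zero.2 (continuousOn_clm_apply.2 fun v z hz => ?_)⟩
    exact (differentiableAt_fderiv_apply_of_differentiableOn hU hg hz v).continuousAt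
      |>.continuousWithinAt
  rw [← one_add_one_eq_two, contDiffOn_succ_iff_fderiv_of_isOpen hU]
  refine ⟨hf, by simp, contDiffOn_clm_apply.2 fun v => hC1 fun z hz => ?_⟩
  exact (differentiableAt_fderiv_apply_of_differentiableOn hU hf hz v).differentiableWithinAt

end Holomorphic

section Wirtinger

variable {n : ℕ} {f g : (Fin n → ℂ) → ℂ} {z : Fin n → ℂ}

theorem Filter.EventuallyEq.wirtingerDBar_eq (h : f =ᶠ[nhds z] g) (γ : Fin n) :
    wirtingerDBar f γ z = wirtingerDBar g γ z := by
  simp only [wirtingerDBar, h.fderiv_eq]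

theorem wirtingerDBar_of_differentiableAt (hf : DifferentiableAt ℂ f z) (γ : Fin n) :
    wirtingerDBar f γ z = 0 := by
  have hsingle : (Pi.single γ Complex.I : Fin n → ℂ) = Complex.I • Pi.single γ 1 := by
    rw [← Pi.single_smul, smul_eq_mul, mul_one]
  have hI : Complex.I * (Complex.I * fderiv ℂ f z (Pi.single γ 1)) =
      -fderiv ℂ f z (Pi.single γ 1) := by
    rw [← mul_assoc, Complex.I_mul_I, neg_one_mul]
  rw [wirtingerDBar, hf.fderiv_restrictScalars ℝ, ContinuousLinearMap.coe_restrictScalars',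
    hsingle, map_smul, smul_eq_mul, hI, add_neg_cancel, mul_zero]

theorem wirtingerDBar_add (hf : DifferentiableAt ℝ f z) (hg : DifferentiableAt ℝ g z)
    (γ : Fin n) :
    wirtingerDBar (fun w => f w + g w) γ z = wirtingerDBar f γ z + wirtingerDBar g γ z := by
  simp only [wirtingerDBar, fderiv_fun_add hf hg, _root_.add_apply]
  ring

theorem wirtingerDBar_sub (hf : DifferentiableAt ℝ f z) (hg : DifferentiableAt ℝ g z)
    (γ : Fin n) :
    wirtingerDBar (fun w => f w - g w) γ z = wirtingerDBar f γ z - wirtingerDBar g γ z := by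
  simp only [wirtingerDBar, fderiv_fun_sub hf hg, _root_.sub_apply]
  ring

theorem wirtingerDBar_mul_of_differentiableAt (hf : DifferentiableAt ℝ f z)
    (hg : DifferentiableAt ℂ g z) (γ : Fin n) :
    wirtingerDBar (fun w => f w * g w) γ z = wirtingerDBar f γ z * g z := by
  have hg0 := wirtingerDBar_of_differentiableAt hg γ
  simp only [wirtingerDBar] at hg0 ⊢
  simp only [fderiv_fun_mul hf (hg.restrictScalars ℝ), _root_.add_apply,
    _root_.smul_apply, smul_eq_mul]
  linear_combination f z * hg0

theorem ContDiffAt.differentiableAt_fderiv_apply_const (hf : ContDiffAt ℝ 2 f z)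
    (v : Fin n → ℂ) : DifferentiableAt ℝ (fun w => fderiv ℝ f w v) z :=
  ((hf.fderiv_right (m := 1) (by norm_num)).differentiableAt one_ne_zero).clm_apply
    (differentiableAt_const v)

theorem ContDiffAt.differentiableAt_wirtingerD (hf : ContDiffAt ℝ 2 f z) (α : Fin n) :
    DifferentiableAt ℝ (wirtingerD f α) z :=
  ((hf.differentiableAt_fderiv_apply_const _).sub
    ((hf.differentiableAt_fderiv_apply_const _).const_mul _)).const_mul _

/-- Mixed Wirtinger derivatives of a `C²` function commute. -/
theorem ContDiffAt.wirtingerDBar_wirtingerD (hf : ContDiffAt ℝ 2 f z) (α γ : Fin n) :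
    wirtingerDBar (wirtingerD f α) γ z = wirtingerD (wirtingerDBar f γ) α z := by
  have hd := hf.differentiableAt_fderiv_apply_const
  have hd' : DifferentiableAt ℝ (fderiv ℝ f) z :=
    (hf.fderiv_right (m := 1) (by norm_num)).differentiableAt one_ne_zero
  have happ (v w : Fin n → ℂ) :
      fderiv ℝ (fun y => fderiv ℝ f y v) z w = fderiv ℝ (fderiv ℝ f) z w v := by
    simp [fderiv_clm_apply hd' (differentiableAt_const v)]
  have hD (v : Fin n → ℂ) : fderiv ℝ (wirtingerD f α) z v = (1 / 2 : ℂ) *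
      (fderiv ℝ (fderiv ℝ f) z v (Pi.single α 1)
        - Complex.I * fderiv ℝ (fderiv ℝ f) z v (Pi.single α Complex.I)) := by
    unfold wirtingerD
    rw [fderiv_const_mul ((hd _).fun_sub ((hd _).const_mul _)),
      fderiv_fun_sub (hd _) ((hd _).const_mul _), fderiv_const_mul (hd _)]
    simp [happ]
  have hDBar (v : Fin n → ℂ) : fderiv ℝ (wirtingerDBar f γ) z v = (1 / 2 : ℂ) *
      (fderiv ℝ (fderiv ℝ f) z v (Pi.single γ 1)
        + Complex.I * fderiv ℝ (fderiv ℝ f) z v (Pi.single γ Complex.I)) := by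
    unfold wirtingerDBar
    rw [fderiv_const_mul ((hd _).fun_add ((hd _).const_mul _)),
      fderiv_fun_add (hd _) ((hd _).const_mul _), fderiv_const_mul (hd _)]
    simp [happ, mul_add]
  have hsymm : IsSymmSndFDerivAt ℝ f z := hf.isSymmSndFDerivAt (by simp)
  rw [wirtingerDBar, wirtingerD, hD, hD, hDBar, hDBar,
    hsymm (Pi.single γ 1) (Pi.single α 1), hsymm (Pi.single γ 1) (Pi.single α Complex.I),
    hsymm (Pi.single γ Complex.I) (Pi.single α 1),
    hsymm (Pi.single γ Complex.I) (Pi.single α Complex.I)]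
  ring

end Wirtinger

/-- If all `2 × 2` minors formed from a fixed vector `c` and the columns of an invertible matrix of
size at least two vanish, then `c = 0`. -/
theorem Matrix.eq_zero_of_isUnit_of_mul_eq_mul {n : ℕ} (hn : 2 ≤ n)
    {M : Matrix (Fin n) (Fin n) ℂ} (hM : IsUnit M) {c : Fin n → ℂ}
    (h : ∀ α β γ, M α γ * c β = M β γ * c α) : c = 0 := by
  have : Nontrivial (Fin n) := Fin.nontrivial_iff_two_le.2 hn
  ext α
  obtain ⟨β, hβ⟩ := exists_ne α
  have hker : (Pi.single α (c β) - Pi.single β (c α)) ᵥ* M = 0 := by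
    ext γ
    simp only [Matrix.sub_vecMul, Pi.sub_apply, Matrix.single_vecMul, Pi.smul_apply,
      Matrix.row_apply, smul_eq_mul, Pi.zero_apply]
    linear_combination h α β γ
  have hzero := Matrix.vecMul_injective_of_isUnit hM (hker.trans (Matrix.zero_vecMul M).symm)
  simpa [hβ] using congrFun hzero β

/-- Let `n ≥ 2` and let `v = (Z,F)` be a holomorphic section with
`−i⟨v, conj v⟩ > 0` and positive definite metric `g_{αβ̄} = ∂²K/∂z^α∂z̄^β` on `U`
(`K = −log(−i⟨v, conj v⟩)`).  With the Kähler-covariant derivative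
`D_α v = ∂_α v + (∂_α K) v`, if `⟨D_α v, D_β v⟩ = 0` on `U` for all `α, β`, then also
`⟨v, ∂_α v⟩ = 0` on `U` for all `α`. -/
theorem covariant_constraint_implies_section_constraint (n : ℕ) (hn : 2 ≤ n)
    (U : Set (Fin n → ℂ)) (hU : IsOpen U)
    (Z F : (Fin n → ℂ) → (Fin (n + 1) → ℂ))
    (hZ : DifferentiableOn ℂ Z U) (hF : DifferentiableOn ℂ F U)
    (hpos : ∀ z ∈ U, 0 < -Complex.I *
      ∑ I : Fin (n + 1), (Z z I * starRingEnd ℂ (F z I) - F z I * starRingEnd ℂ (Z z I)))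
    (K : (Fin n → ℂ) → ℂ)
    (hK : ∀ z, K z = -Complex.log (-Complex.I *
      ∑ I : Fin (n + 1), (Z z I * starRingEnd ℂ (F z I) - F z I * starRingEnd ℂ (Z z I))))
    (hg : ∀ z ∈ U, Matrix.PosDef (Matrix.of fun α β : Fin n =>
      wirtingerD (wirtingerDBar K β) α z))
    (hDvDv : ∀ z ∈ U, ∀ α β : Fin n,
      ∑ I : Fin (n + 1),
        ((fderiv ℂ Z z (Pi.single α 1) I + wirtingerD K α z * Z z I) *
            (fderiv ℂ F z (Pi.single β 1) I + wirtingerD K β z * F z I)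
          - (fderiv ℂ F z (Pi.single α 1) I + wirtingerD K α z * F z I) *
            (fderiv ℂ Z z (Pi.single β 1) I + wirtingerD K β z * Z z I)) = 0) :
    ∀ z ∈ U, ∀ α : Fin n,
      ∑ I : Fin (n + 1), (Z z I * fderiv ℂ F z (Pi.single α 1) I
        - F z I * fderiv ℂ Z z (Pi.single α 1) I) = 0 := by
  intro z hz
  have hsmooth {G : (Fin n → ℂ) → (Fin (n + 1) → ℂ)} (hG : DifferentiableOn ℂ G U)
      (J : Fin (n + 1)) : ContDiffAt ℝ 2 (fun w => G w J) z :=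
    contDiffAt_pi.1 (((contDiffOn_two_of_differentiableOn hU hG).contDiffAt
      (hU.mem_nhds hz)).restrict_scalars ℝ) J
  have hholo {G : (Fin n → ℂ) → (Fin (n + 1) → ℂ)} (hG : DifferentiableOn ℂ G U)
      (J : Fin (n + 1)) : DifferentiableAt ℂ (fun w => G w J) z :=
    differentiableAt_pi.1 (hG.differentiableAt (hU.mem_nhds hz)) J
  have hholo' {G : (Fin n → ℂ) → (Fin (n + 1) → ℂ)} (hG : DifferentiableOn ℂ G U)
      (α : Fin n) (J : Fin (n + 1)) :
      DifferentiableAt ℂ (fun w => fderiv ℂ G w (Pi.single α 1) J) z :=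
    differentiableAt_pi.1 (differentiableAt_fderiv_apply_of_differentiableOn hU hG hz _) J
  have hKsmooth : ContDiffAt ℝ 2 K z := by
    rw [funext hK]
    have hconj {g : (Fin n → ℂ) → ℂ} (hg : ContDiffAt ℝ 2 g z) :
        ContDiffAt ℝ 2 (fun w => starRingEnd ℂ (g w)) z :=
      Complex.conjCLE.contDiff.contDiffAt.comp z hg
    have hN : ContDiffAt ℝ 2 (fun w => -Complex.I * ∑ J : Fin (n + 1),
        (Z w J * starRingEnd ℂ (F w J) - F w J * starRingEnd ℂ (Z w J))) z :=
      contDiffAt_const.mul (ContDiffAt.sum fun J _ =>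
        ((hsmooth hZ J).mul (hconj (hsmooth hF J))).sub
          ((hsmooth hF J).mul (hconj (hsmooth hZ J))))
    have hlog := (Complex.contDiffAt_log (n := 2)
      (Or.inl (Complex.pos_iff.1 (hpos z hz)).1)).restrict_scalars ℝ
    exact (hlog.comp z hN).neg
  set ω : Fin n → (Fin n → ℂ) → ℂ := fun α w => ∑ J : Fin (n + 1),
    (Z w J * fderiv ℂ F w (Pi.single α 1) J - F w J * fderiv ℂ Z w (Pi.single α 1) J) with hω
  set A : Fin n → Fin n → (Fin n → ℂ) → ℂ := fun α β w => ∑ J : Fin (n + 1),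
    (fderiv ℂ Z w (Pi.single α 1) J * fderiv ℂ F w (Pi.single β 1) J
      - fderiv ℂ F w (Pi.single α 1) J * fderiv ℂ Z w (Pi.single β 1) J) with hA
  have hωd (α : Fin n) : DifferentiableAt ℂ (ω α) z :=
    DifferentiableAt.fun_sum fun J _ =>
      ((hholo hZ J).mul (hholo' hF α J)).sub ((hholo hF J).mul (hholo' hZ α J))
  have hAd (α β : Fin n) : DifferentiableAt ℂ (A α β) z :=
    DifferentiableAt.fun_sum fun J _ =>
      ((hholo' hZ α J).mul (hholo' hF β J)).sub ((hholo' hF α J).mul (hholo' hZ β J))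
  have hconstraint (α β : Fin n) :
      (fun w => A α β w + (wirtingerD K α w * ω β w - wirtingerD K β w * ω α w))
        =ᶠ[nhds z] fun _ => 0 := by
    filter_upwards [hU.mem_nhds hz] with w hw
    rw [← hDvDv w hw α β]
    simp only [hA, hω, Finset.mul_sum, ← Finset.sum_sub_distrib, ← Finset.sum_add_distrib]
    exact Finset.sum_congr rfl fun J _ => by ring
  have hminor (α β γ : Fin n) : wirtingerD (wirtingerDBar K γ) α z * ω β z =
      wirtingerD (wirtingerDBar K γ) β z * ω α z := by
    have h := (hconstraint α β).wirtingerDBar_eq γ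
    have hKω (μ ν : Fin n) : DifferentiableAt ℝ (fun w => wirtingerD K μ w * ω ν w) z :=
      (hKsmooth.differentiableAt_wirtingerD μ).mul ((hωd ν).restrictScalars ℝ)
    rw [wirtingerDBar_add ((hAd α β).restrictScalars ℝ) ((hKω α β).fun_sub (hKω β α)),
      wirtingerDBar_sub (hKω α β) (hKω β α),
      wirtingerDBar_of_differentiableAt (hAd α β),
      wirtingerDBar_mul_of_differentiableAt (hKsmooth.differentiableAt_wirtingerD α) (hωd β),
      wirtingerDBar_mul_of_differentiableAt (hKsmooth.differentiableAt_wirtingerD β) (hωd α),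
      wirtingerDBar_of_differentiableAt (differentiableAt_const 0),
      hKsmooth.wirtingerDBar_wirtingerD, hKsmooth.wirtingerDBar_wirtingerD] at h
    linear_combination h
  exact congrFun (Matrix.eq_zero_of_isUnit_of_mul_eq_mul hn (hg z hz).isUnit
    (c := fun α => ω α z) hminor)
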